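/- arXiv:1210.7485 — 2 statements merged into one kernel-verified Lean document; each statement's English description precedes it below -/
import Mathlib

section
/- Let h₁,…,h_k : [0,1]² → ℝ be continuous functions, let λ₁,…,λ_k ∈ ℝ, and let d₁, d₂ : [0,1] → ℝ be continuous strictly positive functions such that c*(u,v) = d₁(u)·d₂(v)·exp(λ₁h₁(u,v) + … + λ_k h_k(u,v)) is a copula density. Then c* has minimum information with respect to the uniform distribution among all copula densities satisfying the same moment constraints: for every copula density c with ∫∫_{[0,1]²} h_i(u,v) c(u,v) du dv = ∫∫_{[0,1]²} h_i(u,v) c*(u,v) du dv for all i = 1,…,k, and such that (u,v) ↦ c(u,v)·ln c(u,v) is integrable (with the convention 0·ln 0 = 0), one has ∫∫_{[0,1]²} c(u,v) ln c(u,v) du dv ≥ ∫∫_{[0,1]²} c*(u,v) ln c*(u,v) du dv. -/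
open MeasureTheory

/-- The unit square `[0,1] × [0,1]` in `ℝ²`. -/
def unitSquare : Set (ℝ × ℝ) := (Set.Icc (0:ℝ) 1) ×ˢ (Set.Icc (0:ℝ) 1)

/-- A copula density on `[0,1]²`: a continuous nonnegative function whose horizontal and
vertical sections all integrate to `1`. -/
def IsCopulaDensity (c : ℝ → ℝ → ℝ) : Prop :=
  ContinuousOn (fun p : ℝ × ℝ => c p.1 p.2) unitSquare ∧
  (∀ u ∈ Set.Icc (0:ℝ) 1, ∀ v ∈ Set.Icc (0:ℝ) 1, 0 ≤ c u v) ∧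
  (∀ u ∈ Set.Icc (0:ℝ) 1, ∫ v in (0:ℝ)..1, c u v = 1) ∧
  (∀ v ∈ Set.Icc (0:ℝ) 1, ∫ u in (0:ℝ)..1, c u v = 1)

theorem isCompact_unitSquare : IsCompact unitSquare :=
  isCompact_Icc.prod isCompact_Icc

theorem measurableSet_unitSquare : MeasurableSet unitSquare :=
  measurableSet_Icc.prod measurableSet_Icc

theorem integrableOn_unitSquare {f : ℝ × ℝ → ℝ} (hf : ContinuousOn f unitSquare) :
    IntegrableOn f unitSquare :=
  hf.integrableOn_compact isCompact_unitSquare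

theorem continuousOn_comp_fst_unitSquare {f : ℝ → ℝ} (hf : ContinuousOn f (Set.Icc (0:ℝ) 1)) :
    ContinuousOn (fun p : ℝ × ℝ => f p.1) unitSquare :=
  hf.comp continuousOn_fst fun _ hp => hp.1

theorem continuousOn_comp_snd_unitSquare {f : ℝ → ℝ} (hf : ContinuousOn f (Set.Icc (0:ℝ) 1)) :
    ContinuousOn (fun p : ℝ × ℝ => f p.2) unitSquare :=
  hf.comp continuousOn_snd fun _ hp => hp.2

/-- Transposing the arguments of a copula density gives a copula density. -/
theorem IsCopulaDensity.swap {c : ℝ → ℝ → ℝ} (hc : IsCopulaDensity c) :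
    IsCopulaDensity fun u v => c v u :=
  ⟨hc.1.comp continuous_swap.continuousOn fun _ hp => ⟨hp.2, hp.1⟩,
    fun u hu v hv => hc.2.1 v hv u hu, hc.2.2.2, hc.2.2.1⟩

/-- The first marginal of a copula density is uniform. -/
theorem IsCopulaDensity.setIntegral_fst_mul {c : ℝ → ℝ → ℝ} (hc : IsCopulaDensity c)
    {f : ℝ → ℝ} (hf : ContinuousOn f (Set.Icc (0:ℝ) 1)) :
    ∫ p in unitSquare, f p.1 * c p.1 p.2 = ∫ u in Set.Icc (0:ℝ) 1, f u := by
  have hint := integrableOn_unitSquare ((continuousOn_comp_fst_unitSquare hf).fun_mul hc.1)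
  rw [unitSquare, Measure.volume_eq_prod] at *
  rw [setIntegral_prod _ hint]
  refine setIntegral_congr_fun measurableSet_Icc fun u hu => ?_
  have hmarg := hc.2.2.1 u hu
  rw [intervalIntegral.integral_of_le zero_le_one, ← integral_Icc_eq_integral_Ioc] at hmarg
  simp only [integral_const_mul, hmarg, mul_one]

/-- The second marginal of a copula density is uniform. -/
theorem IsCopulaDensity.setIntegral_snd_mul {c : ℝ → ℝ → ℝ} (hc : IsCopulaDensity c)
    {f : ℝ → ℝ} (hf : ContinuousOn f (Set.Icc (0:ℝ) 1)) :
    ∫ p in unitSquare, f p.2 * c p.1 p.2 = ∫ v in Set.Icc (0:ℝ) 1, f v := by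
  rw [← hc.swap.setIntegral_fst_mul hf, unitSquare, Measure.volume_eq_prod]
  exact setIntegral_prod_swap _ _ fun p : ℝ × ℝ => f p.1 * c p.2 p.1

theorem IsCopulaDensity.setIntegral_eq_one {c : ℝ → ℝ → ℝ} (hc : IsCopulaDensity c) :
    ∫ p in unitSquare, c p.1 p.2 = 1 := by
  simpa using hc.setIntegral_fst_mul (f := fun _ => 1) continuousOn_const

/-- Integral against a copula density of a function that is additively separable up to a linear
combination of the `h i`. -/
theorem IsCopulaDensity.setIntegral_separable_add_sum_mul {c : ℝ → ℝ → ℝ}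
    (hc : IsCopulaDensity c) {ι : Type*} [Fintype ι] {h : ι → ℝ → ℝ → ℝ}
    (hcont : ∀ i, ContinuousOn (fun p : ℝ × ℝ => h i p.1 p.2) unitSquare) (lam : ι → ℝ)
    {f g : ℝ → ℝ} (hf : ContinuousOn f (Set.Icc (0:ℝ) 1))
    (hg : ContinuousOn g (Set.Icc (0:ℝ) 1)) :
    ∫ p in unitSquare, (f p.1 + g p.2 + ∑ i, lam i * h i p.1 p.2) * c p.1 p.2
      = (∫ u in Set.Icc (0:ℝ) 1, f u) + (∫ v in Set.Icc (0:ℝ) 1, g v)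
        + ∑ i, lam i * ∫ p in unitSquare, h i p.1 p.2 * c p.1 p.2 := by
  have hfi := integrableOn_unitSquare ((continuousOn_comp_fst_unitSquare hf).fun_mul hc.1)
  have hgi := integrableOn_unitSquare ((continuousOn_comp_snd_unitSquare hg).fun_mul hc.1)
  have hhi : ∀ i, IntegrableOn (fun p : ℝ × ℝ => lam i * (h i p.1 p.2 * c p.1 p.2)) unitSquare :=
    fun i => (integrableOn_unitSquare ((hcont i).mul hc.1)).const_mul (lam i)
  simp only [add_mul, Finset.sum_mul, mul_assoc]
  rw [integral_add (hfi.fun_add hgi) (integrable_finsetSum _ fun i _ => hhi i),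
    integral_add hfi hgi, integral_finsetSum _ fun i _ => hhi i,
    hc.setIntegral_fst_mul hf, hc.setIntegral_snd_mul hg]
  simp only [integral_const_mul]

/-- The pointwise form of Gibbs' inequality. -/
theorem Real.log_mul_add_sub_le_mul_log {a b : ℝ} (ha : 0 ≤ a) (hb : 0 < b) :
    Real.log b * a + (a - b) ≤ a * Real.log a := by
  rcases ha.eq_or_lt with rfl | ha
  · simpa using hb.le
  · have hlog := Real.log_le_sub_one_of_pos (div_pos hb ha)
    rw [Real.log_div hb.ne' ha.ne'] at hlog
    have hmul := mul_le_mul_of_nonneg_left hlog ha.le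
    have hdiv : a * (b / a - 1) = b - a := by field_simp
    linarith

/-- **Minimum information property of the exponential-family copula.** If
`c* (u,v) = d₁ u * d₂ v * exp (∑ i, λ i * h i u v)` is a copula density (with `d₁, d₂`
continuous and strictly positive and the `h i` continuous), then among all copula densities
`c` with the same moments `∫∫ hᵢ c = ∫∫ hᵢ c*` and with `c · ln c` integrable (the
convention `0 · ln 0 = 0` being built into `Real.log 0 = 0`), the relative entropy
`∫∫ c ln c` is minimized by `c*`. -/
theorem minimum_information_copula (k : ℕ) (h : Fin k → ℝ → ℝ → ℝ)
    (hcont : ∀ i, ContinuousOn (fun p : ℝ × ℝ => h i p.1 p.2) unitSquare)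
    (lam : Fin k → ℝ) (d1 d2 : ℝ → ℝ)
    (hd1c : ContinuousOn d1 (Set.Icc (0:ℝ) 1)) (hd2c : ContinuousOn d2 (Set.Icc (0:ℝ) 1))
    (hd1pos : ∀ u ∈ Set.Icc (0:ℝ) 1, 0 < d1 u) (hd2pos : ∀ v ∈ Set.Icc (0:ℝ) 1, 0 < d2 v)
    (cstar : ℝ → ℝ → ℝ)
    (hcstar : ∀ u v, cstar u v = d1 u * d2 v * Real.exp (∑ i, lam i * h i u v))
    (hcstarCop : IsCopulaDensity cstar)
    (c : ℝ → ℝ → ℝ) (hcCop : IsCopulaDensity c)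
    (hcInt : IntegrableOn (fun p : ℝ × ℝ => c p.1 p.2 * Real.log (c p.1 p.2)) unitSquare)
    (hmom : ∀ i, ∫ p in unitSquare, h i p.1 p.2 * c p.1 p.2
      = ∫ p in unitSquare, h i p.1 p.2 * cstar p.1 p.2) :
    ∫ p in unitSquare, cstar p.1 p.2 * Real.log (cstar p.1 p.2)
      ≤ ∫ p in unitSquare, c p.1 p.2 * Real.log (c p.1 p.2) := by
  have hlog1 : ContinuousOn (fun u => Real.log (d1 u)) (Set.Icc (0:ℝ) 1) :=
    hd1c.log fun u hu => (hd1pos u hu).ne'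
  have hlog2 : ContinuousOn (fun v => Real.log (d2 v)) (Set.Icc (0:ℝ) 1) :=
    hd2c.log fun v hv => (hd2pos v hv).ne'
  have hpos : ∀ p ∈ unitSquare, 0 < cstar p.1 p.2 := fun p hp => by
    rw [hcstar]
    exact mul_pos (mul_pos (hd1pos _ hp.1) (hd2pos _ hp.2)) (Real.exp_pos _)
  have hlog : ∀ p ∈ unitSquare, Real.log (cstar p.1 p.2)
      = Real.log (d1 p.1) + Real.log (d2 p.2) + ∑ i, lam i * h i p.1 p.2 := fun p hp => by
    have h1 := (hd1pos _ hp.1).ne'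
    have h2 := (hd2pos _ hp.2).ne'
    rw [hcstar, Real.log_mul (mul_ne_zero h1 h2) (Real.exp_ne_zero _), Real.log_mul h1 h2,
      Real.log_exp]
  have hcross : ∀ {e : ℝ → ℝ → ℝ}, IsCopulaDensity e →
      ∫ p in unitSquare, Real.log (cstar p.1 p.2) * e p.1 p.2
        = (∫ u in Set.Icc (0:ℝ) 1, Real.log (d1 u)) + (∫ v in Set.Icc (0:ℝ) 1, Real.log (d2 v))
          + ∑ i, lam i * ∫ p in unitSquare, h i p.1 p.2 * e p.1 p.2 := fun he => by
    rw [← he.setIntegral_separable_add_sum_mul hcont lam hlog1 hlog2]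
    exact setIntegral_congr_fun measurableSet_unitSquare fun p hp => by simp only [hlog p hp]
  have hci := integrableOn_unitSquare hcCop.1
  have hsi := integrableOn_unitSquare hcstarCop.1
  have hli := integrableOn_unitSquare
    ((hcstarCop.1.log fun p hp => (hpos p hp).ne').fun_mul hcCop.1)
  calc ∫ p in unitSquare, cstar p.1 p.2 * Real.log (cstar p.1 p.2)
      = ∫ p in unitSquare, Real.log (cstar p.1 p.2) * c p.1 p.2 := by
        simp only [mul_comm (cstar _ _)]
        rw [hcross hcstarCop, hcross hcCop]
        simp only [hmom]
    _ = ∫ p in unitSquare,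
          (Real.log (cstar p.1 p.2) * c p.1 p.2 + (c p.1 p.2 - cstar p.1 p.2)) := by
        rw [integral_add hli (hci.fun_sub hsi), integral_sub hci hsi, hcCop.setIntegral_eq_one,
          hcstarCop.setIntegral_eq_one, sub_self, add_zero]
    _ ≤ ∫ p in unitSquare, c p.1 p.2 * Real.log (c p.1 p.2) :=
        setIntegral_mono_on (hli.add (hci.sub hsi)) hcInt measurableSet_unitSquare fun p hp =>
          Real.log_mul_add_sub_le_mul_log (hcCop.2.1 _ hp.1 _ hp.2) (hpos p hp)
end

section
/- Let h₁,…,h_k : [0,1]² → ℝ be continuous and linearly independent functions, and let S = {(∫∫ h₁ c du dv, …, ∫∫ h_k c du dv) : c a copula density on [0,1]²} ⊆ ℝᵏ. If α = (α₁,…,α_k) lies in the interior of S, then there exist λ₁,…,λ_k ∈ ℝ and continuous strictly positive functions d₁, d₂ : [0,1] → ℝ such that c*(u,v) = d₁(u)d₂(v)exp(λ₁h₁(u,v)+…+λ_k h_k(u,v)) is a copula density satisfying ∫∫_{[0,1]²} h_i(u,v) c*(u,v) du dv = α_i for every i = 1,…,k. -/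
open MeasureTheory

open Set Filter Topology

section DualProblem

set_option linter.unusedSectionVars false

variable {X Y : Type*} [TopologicalSpace X] [CompactSpace X] [T2Space X] [SecondCountableTopology X]
  [MeasurableSpace X] [BorelSpace X] [TopologicalSpace Y] [CompactSpace Y]
  [T2Space Y] [SecondCountableTopology Y] [MeasurableSpace Y] [BorelSpace Y]

theorem Continuous.integrable_of_compactSpace {f : X → ℝ} (hf : Continuous f) (μ : Measure X)
    [IsFiniteMeasure μ] : Integrable f μ :=
  hf.integrable_of_hasCompactSupport (HasCompactSupport.of_compactSpace f)

/-- Ascoli's theorem for the functions that are uniformly bounded and dominated by a given modulus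
of continuity `D`. -/
theorem isCompact_setOf_modulus {Y : Type*} [TopologicalSpace Y] [CompactSpace Y]
    (N : ℝ) (D : Y → Y → ℝ) (hD : ∀ y, Continuous (D y)) (hD0 : ∀ y, D y y = 0) :
    IsCompact {b : C(Y, ℝ) | (∀ y, |b y| ≤ N) ∧ ∀ y y', |b y - b y'| ≤ D y y'} := by
  set S : Set C(Y, ℝ) := {b | (∀ y, |b y| ≤ N) ∧ ∀ y y', |b y - b y'| ≤ D y y'} with hS
  let e := ContinuousMap.isometryEquivBoundedOfCompact Y ℝ
  have hclosed : IsClosed S := by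
    simp only [hS, ofPred_and, ofPred_forall]
    refine (isClosed_iInter fun y => ?_).inter
      (isClosed_iInter fun y => isClosed_iInter fun y' => ?_)
    · exact isClosed_le ((continuous_eval_const y).abs) continuous_const
    · exact isClosed_le (((continuous_eval_const y).sub
        (continuous_eval_const y')).abs) continuous_const
  have key : IsCompact (e.symm ⁻¹' S) := by
    refine BoundedContinuousFunction.arzela_ascoli₂ (Icc (-N) N) isCompact_Icc _
      (hclosed.preimage e.symm.continuous) (fun f x hf => abs_le.1 (hf.1 x)) ?_
    intro y
    rw [Metric.equicontinuousAt_iff_right]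
    intro ε hε
    have h0 : Tendsto (D y) (𝓝 y) (𝓝 0) := hD0 y ▸ (hD y).tendsto y
    filter_upwards [h0.eventually_lt_const hε] with z hz f
    exact (f.2.2 y z).trans_lt hz
  have := key.image e.symm.continuous
  rwa [image_preimage_eq _ e.symm.surjective] at this

/-- The dual objective of the minimum information problem for the log-kernel `W`. -/
noncomputable def dualObjective (μ : Measure X) (ν : Measure Y) (W : C(X × Y, ℝ))
    (a : C(X, ℝ)) (b : C(Y, ℝ)) : ℝ :=
  ∫ p, Real.exp (W p + a p.1 + b p.2) ∂μ.prod ν - ∫ x, a x ∂μ - ∫ y, b y ∂ν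

variable (μ : Measure X) (ν : Measure Y) [IsProbabilityMeasure μ] [IsProbabilityMeasure ν]

theorem continuous_integral_fst {f : X × Y → ℝ} (hf : Continuous f) :
    Continuous fun y => ∫ x, f (x, y) ∂μ := by
  simpa using continuous_parametric_integral_of_continuous (μ := μ)
    (f := fun y x => f (x, y)) (hf.comp continuous_swap) isCompact_univ

theorem continuous_integral_snd {f : X × Y → ℝ} (hf : Continuous f) :
    Continuous fun x => ∫ y, f (x, y) ∂ν := by
  simpa using continuous_parametric_integral_of_continuous (μ := ν)
    (f := fun x y => f (x, y)) hf isCompact_univ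

/-- `b` is the optimal second potential for the log-kernel `W` and the first potential `a`. -/
def IsOptimalPotential (W : C(X × Y, ℝ)) (a : C(X, ℝ)) (b : C(Y, ℝ)) : Prop :=
  ∀ y, Real.exp (-b y) = ∫ x, Real.exp (W (x, y) + a x) ∂μ

theorem exists_isOptimalPotential (W : C(X × Y, ℝ)) (a : C(X, ℝ)) :
    ∃ b : C(Y, ℝ), IsOptimalPotential μ W a b := by
  have hpos : ∀ y, 0 < ∫ x, Real.exp (W (x, y) + a x) ∂μ := fun y =>
    integral_exp_pos (Continuous.integrable_of_compactSpace (by fun_prop) μ)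
  have hc : Continuous fun y => ∫ x, Real.exp (W (x, y) + a x) ∂μ :=
    continuous_integral_fst μ (f := fun p => Real.exp (W p + a p.1)) (by fun_prop)
  refine ⟨⟨fun y => -Real.log (∫ x, Real.exp (W (x, y) + a x) ∂μ),
    (hc.log fun y => (hpos y).ne').neg⟩, fun y => ?_⟩
  simp [Real.exp_log (hpos y)]

variable {μ}

theorem IsOptimalPotential.dualObjective_le {W : C(X × Y, ℝ)} {a : C(X, ℝ)} {b' : C(Y, ℝ)}
    (hb' : IsOptimalPotential μ W a b') (b : C(Y, ℝ)) :
    dualObjective μ ν W a b' ≤ dualObjective μ ν W a b := by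
  have key : ∀ b : C(Y, ℝ), ∫ p, Real.exp (W p + a p.1 + b p.2) ∂μ.prod ν =
      ∫ y, Real.exp (b y - b' y) ∂ν := by
    intro b
    rw [integral_prod_symm _ (Continuous.integrable_of_compactSpace (by fun_prop) _)]
    refine integral_congr_ae (.of_forall fun y => ?_)
    simp only [sub_eq_add_neg (b y), Real.exp_add (b y), hb' y]
    rw [← integral_const_mul]
    refine integral_congr_ae (.of_forall fun x => ?_)
    simp only [Real.exp_add]
    ring
  have hle : ∫ y, (b y - b' y + 1) ∂ν ≤ ∫ y, Real.exp (b y - b' y) ∂ν :=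
    integral_mono (Continuous.integrable_of_compactSpace (by fun_prop) _)
      (Continuous.integrable_of_compactSpace (by fun_prop) _)
      fun y => Real.add_one_le_exp _
  rw [integral_add (Continuous.integrable_of_compactSpace (by fun_prop) _)
      (Continuous.integrable_of_compactSpace (by fun_prop) _),
    integral_sub (b.continuous.integrable_of_compactSpace _)
      (b'.continuous.integrable_of_compactSpace _)] at hle
  simp only [dualObjective, key]
  simp at hle ⊢
  linarith

theorem IsOptimalPotential.le_add {W : C(X × Y, ℝ)} {a : C(X, ℝ)} {b : C(Y, ℝ)}
    (hb : IsOptimalPotential μ W a b) {y y' : Y} {δ : ℝ}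
    (h : ∀ x, W (x, y) ≤ W (x, y') + δ) : b y' ≤ b y + δ := by
  have : Real.exp (-b y) ≤ Real.exp (δ + -b y') := by
    rw [Real.exp_add, hb y, hb y', ← integral_const_mul]
    refine integral_mono (Continuous.integrable_of_compactSpace (by fun_prop) _)
      (Continuous.integrable_of_compactSpace (by fun_prop) _) fun x => ?_
    simp only [← Real.exp_add]
    exact Real.exp_le_exp.2 (by linarith [h x])
  linarith [Real.exp_le_exp.1 this]

theorem IsOptimalPotential.abs_sub_le {W : C(X × Y, ℝ)} {a : C(X, ℝ)} {b : C(Y, ℝ)}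
    (hb : IsOptimalPotential μ W a b) {y y' : Y} {δ : ℝ}
    (h : ∀ x, |W (x, y) - W (x, y')| ≤ δ) : |b y - b y'| ≤ δ := by
  have h1 := hb.le_add (y := y) (y' := y') (δ := δ) fun x => by linarith [(abs_le.1 (h x)).2]
  have h2 := hb.le_add (y := y') (y' := y) (δ := δ) fun x => by linarith [(abs_le.1 (h x)).1]
  exact abs_le.2 ⟨by linarith, by linarith⟩

theorem IsOptimalPotential.abs_le {W : C(X × Y, ℝ)} {a : C(X, ℝ)} {b : C(Y, ℝ)}
    (hb : IsOptimalPotential μ W a b) {y : Y} {M : ℝ}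
    (h : ∀ x, |W (x, y) + a x| ≤ M) : |b y| ≤ M := by
  have hi : Integrable (fun x => Real.exp (W (x, y) + a x)) μ :=
    Continuous.integrable_of_compactSpace (by fun_prop) _
  have h1 : Real.exp (-b y) ≤ Real.exp M := by
    rw [hb y]
    simpa using integral_mono hi (integrable_const (Real.exp M))
      fun x => Real.exp_le_exp.2 (_root_.abs_le.1 (h x)).2
  have h2 : Real.exp (-M) ≤ Real.exp (-b y) := by
    rw [hb y]
    simpa using integral_mono (integrable_const (Real.exp (-M))) hi
      fun x => Real.exp_le_exp.2 (_root_.abs_le.1 (h x)).1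
  exact _root_.abs_le.2 ⟨by linarith [Real.exp_le_exp.1 h1], by linarith [Real.exp_le_exp.1 h2]⟩

variable (μ)

theorem dualObjective_swap (W : C(X × Y, ℝ)) (a : C(X, ℝ))
    (b : C(Y, ℝ)) :
    dualObjective ν μ (W.comp .prodSwap) b a = dualObjective μ ν W a b := by
  have := integral_prod_swap (μ := μ) (ν := ν) fun p => Real.exp (W p + a p.1 + b p.2)
  have hswap : ∀ p : Y × X, Real.exp ((W.comp .prodSwap) p + b p.1 + a p.2) =
      Real.exp (W p.swap + a p.swap.1 + b p.swap.2) := fun p => by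
    rw [add_right_comm]; rfl
  simp only [dualObjective, ← this, hswap]
  ring

theorem dualObjective_shift (W : C(X × Y, ℝ)) (a : C(X, ℝ)) (b : C(Y, ℝ)) (t : ℝ) :
    dualObjective μ ν W (a + .const X t) (b - .const Y t) = dualObjective μ ν W a b := by
  simp only [dualObjective, ContinuousMap.add_apply, ContinuousMap.sub_apply,
    ContinuousMap.const_apply]
  rw [integral_add (a.continuous.integrable_of_compactSpace _) (integrable_const _),
    integral_sub (b.continuous.integrable_of_compactSpace _) (integrable_const _)]
  simp only [integral_const, probReal_univ, one_smul]
  have : ∀ p : X × Y, W p + (a p.1 + t) + (b p.2 - t) = W p + a p.1 + b p.2 := fun p => by ring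
  simp only [this]
  ring

theorem IsOptimalPotential.shift {W : C(X × Y, ℝ)} {a : C(X, ℝ)} {b : C(Y, ℝ)}
    (hb : IsOptimalPotential μ W a b) (t : ℝ) :
    IsOptimalPotential μ W (a + .const X t) (b - .const Y t) := by
  intro y
  have : ∀ x, Real.exp (W (x, y) + (a + ContinuousMap.const X t) x) =
      Real.exp (W (x, y) + a x) * Real.exp t := fun x => by
    rw [← Real.exp_add, ContinuousMap.add_apply, ContinuousMap.const_apply, add_assoc]
  simp only [this, integral_mul_const, ← hb y]
  rw [← Real.exp_add, ContinuousMap.sub_apply, ContinuousMap.const_apply]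
  ring_nf

/-- A continuous density of `μ` with respect to itself is identically `1`. -/
theorem eq_one_of_forall_integral_mul [μ.IsOpenPosMeasure] {m : X → ℝ} (hm : Continuous m)
    (h : ∀ g : C(X, ℝ), ∫ x, g x * m x ∂μ = ∫ x, g x ∂μ) (x : X) : m x = 1 := by
  have h0 : ∫ x, (m x - 1) * (m x - 1) ∂μ = 0 := by
    have h1 := h ⟨fun x => m x - 1, by fun_prop⟩
    simp only [ContinuousMap.coe_mk] at h1
    simp only [mul_sub_one]
    rw [integral_sub (Continuous.integrable_of_compactSpace (by fun_prop) _)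
      (Continuous.integrable_of_compactSpace (by fun_prop) _), h1, sub_self]
  have hc : Continuous fun x => (m x - 1) * (m x - 1) := by fun_prop
  rw [integral_eq_zero_iff_of_nonneg (fun x => mul_self_nonneg _)
    (hc.integrable_of_compactSpace _)] at h0
  have h2 := (Continuous.ae_eq_iff_eq μ hc continuous_const).1 h0
  exact sub_eq_zero.1 (mul_self_eq_zero.1 (congrFun h2 x))

variable {ι : Type*} [Fintype ι]

/-- The log-kernel `∑ i, l i * H i`. -/
def logKernel (H : ι → C(X × Y, ℝ)) (l : ι → ℝ) : C(X × Y, ℝ) := ∑ i, l i • H i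

theorem logKernel_apply (H : ι → C(X × Y, ℝ)) (l : ι → ℝ) (p : X × Y) :
    logKernel H l p = ∑ i, l i * H i p := by
  simp [logKernel, ContinuousMap.sum_apply]

theorem abs_logKernel_le (H : ι → C(X × Y, ℝ)) {l : ι → ℝ} {R : ℝ} (hl : ∀ i, |l i| ≤ R)
    (p : X × Y) : |logKernel H l p| ≤ ∑ i, R * ‖H i‖ := by
  rw [logKernel_apply]
  refine (Finset.abs_sum_le_sum_abs _ _).trans (Finset.sum_le_sum fun i _ => ?_)
  rw [abs_mul]
  exact mul_le_mul (hl i) ((H i).norm_coe_le_norm p) (abs_nonneg _) ((abs_nonneg _).trans (hl i))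

theorem abs_logKernel_sub_le (H : ι → C(X × Y, ℝ)) {l : ι → ℝ} {R : ℝ} (hl : ∀ i, |l i| ≤ R)
    (x : X) (y y' : Y) : |logKernel H l (x, y) - logKernel H l (x, y')| ≤
      ∑ i, R * dist (((H i).comp .prodSwap).curry y) (((H i).comp .prodSwap).curry y') := by
  rw [logKernel_apply, logKernel_apply, ← Finset.sum_sub_distrib]
  refine (Finset.abs_sum_le_sum_abs _ _).trans (Finset.sum_le_sum fun i _ => ?_)
  rw [← mul_sub, abs_mul]
  exact mul_le_mul (hl i) (ContinuousMap.dist_apply_le_dist (f := ((H i).comp .prodSwap).curry y)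
    (g := ((H i).comp .prodSwap).curry y') x) (abs_nonneg _) ((abs_nonneg _).trans (hl i))

/-- For a bounded set of parameters, the potentials can be confined to compact sets without
increasing the dual objective. -/
theorem exists_compact_potentials (H : ι → C(X × Y, ℝ)) (R : ℝ) :
    ∃ (A : Set C(X, ℝ)) (B : Set C(Y, ℝ)), IsCompact A ∧ IsCompact B ∧
      ∀ l : ι → ℝ, (∀ i, |l i| ≤ R) → ∀ a b, ∃ a' ∈ A, ∃ b' ∈ B,
        dualObjective μ ν (logKernel H l) a' b' ≤ dualObjective μ ν (logKernel H l) a b := by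
  let M := ∑ i, R * ‖H i‖
  let H' : ι → C(Y × X, ℝ) := fun i => (H i).comp .prodSwap
  refine ⟨_, _,
    isCompact_setOf_modulus (3 * M)
      (fun x x' => ∑ i, R * dist (((H' i).comp .prodSwap).curry x) (((H' i).comp .prodSwap).curry x'))
      (fun x => by fun_prop) (fun x => by simp),
    isCompact_setOf_modulus (2 * M)
      (fun y y' => ∑ i, R * dist (((H i).comp .prodSwap).curry y) (((H i).comp .prodSwap).curry y'))
      (fun y => by fun_prop) (fun y => by simp), fun l hl a b => ?_⟩
  have hswap : (logKernel H l).comp .prodSwap = logKernel H' l := by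
    ext p
    simp [logKernel_apply, H']
  obtain ⟨y₀⟩ := ν.nonempty_of_neZero
  obtain ⟨b₁, hb₁⟩ := exists_isOptimalPotential μ (logKernel H l) a
  have hb₂ := hb₁.shift μ (b₁ y₀)
  set b₂ := b₁ - ContinuousMap.const Y (b₁ y₀)
  obtain ⟨a₁, ha₁⟩ := exists_isOptimalPotential ν ((logKernel H l).comp .prodSwap) b₂
  have hb₂_bound : ∀ y, |b₂ y| ≤ 2 * M := fun y => by
    have : b₂ y = b₁ y - b₁ y₀ := rfl
    rw [this]
    refine hb₁.abs_sub_le fun x => (abs_sub _ _).trans ?_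
    linarith [abs_logKernel_le H hl (x, y), abs_logKernel_le H hl (x, y₀)]
  refine ⟨a₁, ⟨fun x => ha₁.abs_le fun y => (abs_add_le _ _).trans ?_, fun x x' => ?_⟩,
    b₂, ⟨hb₂_bound, fun y y' => ?_⟩, ?_⟩
  · have := abs_logKernel_le H hl (x, y)
    have := hb₂_bound y
    simp only [ContinuousMap.comp_apply, ContinuousMap.prodSwap_apply]
    linarith
  · rw [hswap] at ha₁
    exact ha₁.abs_sub_le fun y => abs_logKernel_sub_le H' hl y x x'
  · exact hb₂.abs_sub_le fun x => abs_logKernel_sub_le H hl x y y'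
  · calc dualObjective μ ν (logKernel H l) a₁ b₂
        = dualObjective ν μ ((logKernel H l).comp .prodSwap) b₂ a₁ :=
          (dualObjective_swap μ ν _ _ _).symm
      _ ≤ dualObjective ν μ ((logKernel H l).comp .prodSwap) b₂ (a + .const X (b₁ y₀)) :=
          ha₁.dualObjective_le μ _
      _ = dualObjective μ ν (logKernel H l) a b₁ := by
          rw [dualObjective_swap, dualObjective_shift]
      _ ≤ _ := hb₁.dualObjective_le ν b

theorem continuous_integral_continuousMap : Continuous fun f : C(X, ℝ) => ∫ x, f x ∂μ := by
  refine Metric.continuous_iff.2 fun f ε hε => ⟨ε, hε, fun g hg => ?_⟩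
  rw [Real.dist_eq, ← integral_sub (g.continuous.integrable_of_compactSpace _)
    (f.continuous.integrable_of_compactSpace _)]
  refine lt_of_le_of_lt ?_ hg
  simpa using norm_integral_le_of_norm_le_const (μ := μ) (f := fun x => g x - f x)
    (C := dist g f) (.of_forall fun x => ContinuousMap.dist_apply_le_dist (f := g) (g := f) x)

theorem continuous_dualObjective (H : ι → C(X × Y, ℝ)) :
    Continuous fun q : (ι → ℝ) × C(X, ℝ) × C(Y, ℝ) =>
      dualObjective μ ν (logKernel H q.1) q.2.1 q.2.2 := by
  have h1 : Continuous fun q : (ι → ℝ) × C(X, ℝ) × C(Y, ℝ) =>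
      (⟨Real.exp, Real.continuous_exp⟩ : C(ℝ, ℝ)).comp
        (logKernel H q.1 + q.2.1.comp .fst + q.2.2.comp .snd) := by
    unfold logKernel
    fun_prop
  exact (((continuous_integral_continuousMap (μ.prod ν)).comp h1).sub
    ((continuous_integral_continuousMap μ).comp (by fun_prop))).sub
    ((continuous_integral_continuousMap ν).comp (by fun_prop))

/-- Young's inequality for the conjugate pair `exp` and `c * log c - c`. -/
theorem mul_le_exp_add_mul_log_sub {c : ℝ} (hc : 0 ≤ c) (x : ℝ) :
    x * c ≤ Real.exp x + (c * Real.log c - c) := by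
  rcases hc.eq_or_lt with rfl | hc
  · simpa using (Real.exp_pos x).le
  · have h1 := mul_le_mul_of_nonneg_left (Real.add_one_le_exp (x - Real.log c)) hc.le
    rw [Real.exp_sub, Real.exp_log hc, mul_div_cancel₀ _ hc.ne'] at h1
    linarith

/-- Weak duality. -/
theorem exists_le_dualObjective (c : C(X × Y, ℝ)) (hc : ∀ p, 0 ≤ c p)
    (hc1 : ∀ x, ∫ y, c (x, y) ∂ν = 1) (hc2 : ∀ y, ∫ x, c (x, y) ∂μ = 1) :
    ∃ C, ∀ W a b, ∫ p, W p * c p ∂μ.prod ν - C ≤ dualObjective μ ν W a b := by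
  refine ⟨∫ p, (c p * Real.log (c p) - c p) ∂μ.prod ν, fun W a b => ?_⟩
  have hlog : Continuous fun p => c p * Real.log (c p) - c p :=
    (Real.continuous_mul_log.comp c.continuous).sub c.continuous
  have hle : ∫ p, (W p + a p.1 + b p.2) * c p ∂μ.prod ν ≤
      ∫ p, (Real.exp (W p + a p.1 + b p.2) + (c p * Real.log (c p) - c p)) ∂μ.prod ν :=
    integral_mono (Continuous.integrable_of_compactSpace (by fun_prop) _)
      (Continuous.integrable_of_compactSpace (by fun_prop) _)
      fun p => mul_le_exp_add_mul_log_sub (hc p) _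
  rw [integral_add (Continuous.integrable_of_compactSpace (by fun_prop) _)
    (hlog.integrable_of_compactSpace _)] at hle
  have hsplit : ∀ p : X × Y, (W p + a p.1 + b p.2) * c p = W p * c p + a p.1 * c p + b p.2 * c p :=
    fun p => by ring
  have ha : ∫ p, a p.1 * c p ∂μ.prod ν = ∫ x, a x ∂μ := by
    rw [integral_prod _ (Continuous.integrable_of_compactSpace (by fun_prop) _)]
    simp [integral_const_mul, hc1]
  have hb : ∫ p, b p.2 * c p ∂μ.prod ν = ∫ y, b y ∂ν := by
    rw [integral_prod_symm _ (Continuous.integrable_of_compactSpace (by fun_prop) _)]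
    simp [integral_const_mul, hc2]
  simp only [hsplit] at hle
  rw [integral_add (Continuous.integrable_of_compactSpace (by fun_prop) _)
    (Continuous.integrable_of_compactSpace (by fun_prop) _),
    integral_add (Continuous.integrable_of_compactSpace (by fun_prop) _)
    (Continuous.integrable_of_compactSpace (by fun_prop) _), ha, hb] at hle
  simp only [dualObjective]
  linarith

/-- First-order condition for exponential integrals. -/
theorem integral_mul_exp_eq_of_forall_le {F g : X → ℝ} (hF : Continuous F) (hg : Continuous g)
    {L : ℝ} (h : ∀ t : ℝ, ∫ x, Real.exp (F x) ∂μ ≤ ∫ x, Real.exp (F x + t * g x) ∂μ - t * L) :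
    ∫ x, g x * Real.exp (F x) ∂μ = L := by
  let φ : ℝ → ℝ := fun t => ∫ x, g x * Real.exp (F x + t * g x) ∂μ
  have hφ : Continuous φ := by
    simpa using continuous_parametric_integral_of_continuous (μ := μ)
      (f := fun (t : ℝ) x => g x * Real.exp (F x + t * g x)) (by fun_prop) isCompact_univ
  have hφ0 : φ 0 = ∫ x, g x * Real.exp (F x) ∂μ := by simp [φ]
  have key : ∀ t, t * L ≤ t * φ t := fun t => by
    have hle : ∫ x, (Real.exp (F x + t * g x) - Real.exp (F x)) ∂μ ≤
        ∫ x, t * (g x * Real.exp (F x + t * g x)) ∂μ := by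
      refine integral_mono (Continuous.integrable_of_compactSpace (by fun_prop) _)
        (Continuous.integrable_of_compactSpace (by fun_prop) _) fun x => ?_
      have h1 := mul_le_mul_of_nonneg_left (Real.add_one_le_exp (-(t * g x)))
        (Real.exp_pos (F x + t * g x)).le
      rw [← Real.exp_add, add_neg_cancel_right] at h1
      linarith
    rw [integral_sub (Continuous.integrable_of_compactSpace (by fun_prop) _)
      (Continuous.integrable_of_compactSpace (by fun_prop) _), integral_const_mul] at hle
    linarith [h t]
  rw [← hφ0]
  apply le_antisymm
  · refine le_of_tendsto (f := φ) (x := 𝓝[<] 0) (hφ.continuousWithinAt) ?_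
    filter_upwards [self_mem_nhdsWithin] with t ht
    exact (mul_le_mul_left_of_neg ht).1 (key t)
  · refine ge_of_tendsto (f := φ) (x := 𝓝[>] 0) (hφ.continuousWithinAt) ?_
    filter_upwards [self_mem_nhdsWithin] with t ht
    exact le_of_mul_le_mul_left (key t) ht

/-- Existence of the minimum information density with moments `α` interior to the set
of attainable moments. -/
theorem exists_minimum_information_density [μ.IsOpenPosMeasure]
    [ν.IsOpenPosMeasure] (H : ι → C(X × Y, ℝ)) (α : ι → ℝ)
    (hα : α ∈ interior {β : ι → ℝ | ∃ c : C(X × Y, ℝ), (∀ p, 0 ≤ c p) ∧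
      (∀ x, ∫ y, c (x, y) ∂ν = 1) ∧ (∀ y, ∫ x, c (x, y) ∂μ = 1) ∧
      ∀ i, β i = ∫ p, H i p * c p ∂μ.prod ν}) :
    ∃ (l : ι → ℝ) (a : C(X, ℝ)) (b : C(Y, ℝ)),
      (∀ x, ∫ y, Real.exp (∑ i, l i * H i (x, y) + a x + b y) ∂ν = 1) ∧
      (∀ y, ∫ x, Real.exp (∑ i, l i * H i (x, y) + a x + b y) ∂μ = 1) ∧
      ∀ i, ∫ p, H i p * Real.exp (∑ j, l j * H j p + a p.1 + b p.2) ∂μ.prod ν = α i := by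
  classical
  let J : (ι → ℝ) × C(X, ℝ) × C(Y, ℝ) → ℝ := fun q =>
    dualObjective μ ν (logKernel H q.1) q.2.1 q.2.2 - ∑ i, q.1 i * α i
  have hJ : Continuous J := (continuous_dualObjective μ ν H).sub (by fun_prop)
  have hJ0 : J 0 = 1 := by simp [J, dualObjective, logKernel]
  obtain ⟨ε, hε, hball⟩ := Metric.mem_nhds_iff.1 (mem_interior_iff_mem_nhds.1 hα)
  have hshift : ∀ i (s : ℝ), |s| < ε → ∃ C, ∀ q, s * q.1 i - C ≤ J q := by
    intro i s hs
    obtain ⟨c, hc, hc1, hc2, hcα⟩ := hball (a := α + Pi.single i s)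
      (by simpa [Metric.mem_ball, dist_eq_norm, Pi.norm_single] using hs)
    obtain ⟨C, hC⟩ := exists_le_dualObjective μ ν c hc hc1 hc2
    refine ⟨C, fun q => ?_⟩
    have h1 := hC (logKernel H q.1) q.2.1 q.2.2
    have h2 : ∫ p, logKernel H q.1 p * c p ∂μ.prod ν =
        ∑ j, q.1 j * (α j + (Pi.single i s : ι → ℝ) j) := by
      simp only [logKernel_apply, Finset.sum_mul]
      rw [integral_finsetSum _ fun j _ => Continuous.integrable_of_compactSpace (by fun_prop) _]
      refine Finset.sum_congr rfl fun j _ => ?_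
      simp only [mul_assoc, integral_const_mul, ← hcα j, Pi.add_apply]
    simp only [mul_add, Finset.sum_add_distrib, Pi.single_apply, mul_ite, mul_zero,
      Finset.sum_ite_eq', Finset.mem_univ, if_true] at h2
    rw [h2] at h1
    simp only [J]
    linarith
  have hbound : ∀ i, ∃ R, ∀ q, J q ≤ 1 → |q.1 i| ≤ R := by
    intro i
    obtain ⟨C, hC⟩ := hshift i (ε / 2) (by rw [abs_of_pos] <;> linarith)
    obtain ⟨C', hC'⟩ := hshift i (-(ε / 2)) (by rw [abs_neg, abs_of_pos] <;> linarith)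
    refine ⟨max (1 + C) (1 + C') / (ε / 2), fun q hq => ?_⟩
    rw [le_div_iff₀ (by linarith)]
    rcases abs_cases (q.1 i) with ⟨h, -⟩ | ⟨h, -⟩ <;> rw [h]
    · exact le_max_of_le_left (by linarith [hC q])
    · exact le_max_of_le_right (by linarith [hC' q])
  choose R hR using hbound
  have hR' : ∀ q, J q ≤ 1 → ∀ i, |q.1 i| ≤ ∑ j, |R j| := fun q hq i =>
    ((hR i q hq).trans (le_abs_self _)).trans
      (Finset.single_le_sum (f := fun j => |R j|) (fun j _ => abs_nonneg _) (Finset.mem_univ i))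
  obtain ⟨A, B, hA, hB, hAB⟩ := exists_compact_potentials μ ν H (∑ j, |R j|)
  let K : Set ((ι → ℝ) × C(X, ℝ) × C(Y, ℝ)) :=
    (univ.pi fun _ => Icc (-∑ j, |R j|) (∑ j, |R j|)) ×ˢ (A ×ˢ B)
  have hK : IsCompact K := (isCompact_univ_pi fun _ => isCompact_Icc).prod (hA.prod hB)
  have hdom : ∀ q, J q ≤ 1 → ∃ q' ∈ K, J q' ≤ J q := by
    intro q hq
    obtain ⟨a', ha', b', hb', hle⟩ := hAB q.1 (hR' q hq) q.2.1 q.2.2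
    exact ⟨(q.1, a', b'), ⟨fun i _ => _root_.abs_le.1 (hR' q hq i), ha', hb'⟩,
      sub_le_sub_right hle _⟩
  obtain ⟨q₀, hq₀, hq₀'⟩ := hdom 0 hJ0.le
  obtain ⟨⟨l, a, b⟩, -, hmin⟩ := hK.exists_isMinOn ⟨q₀, hq₀⟩ hJ.continuousOn
  have hglobal : ∀ q, J (l, a, b) ≤ J q := by
    intro q
    rcases le_total (J q) 1 with hq | hq
    · obtain ⟨q', hq', hle⟩ := hdom q hq
      exact (hmin hq').trans hle
    · exact (hmin hq₀).trans (hq₀'.trans (hJ0.le.trans hq))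
  let F : X × Y → ℝ := fun p => logKernel H l p + a p.1 + b p.2
  have hF : Continuous F := by fun_prop
  have hmoment : ∀ i, ∫ p, H i p * Real.exp (F p) ∂μ.prod ν = α i := by
    intro i
    refine integral_mul_exp_eq_of_forall_le _ hF (H i).continuous fun t => ?_
    have h1 := hglobal (l + Pi.single i t, a, b)
    have h2 : ∀ p, logKernel H (l + Pi.single i t) p = logKernel H l p + t * H i p := fun p => by
      simp [logKernel_apply, add_mul, Finset.sum_add_distrib, Pi.single_apply]
    have h3 : ∑ j, (l + Pi.single i t : ι → ℝ) j * α j = ∑ j, l j * α j + t * α i := by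
      simp [add_mul, Finset.sum_add_distrib, Pi.single_apply]
    have h4 : ∀ p, F p + t * H i p = logKernel H l p + t * H i p + a p.1 + b p.2 := fun p => by
      simp only [F]; ring
    simp only [J, dualObjective, h2, h3] at h1
    simp only [h4]
    simp only [F]
    linarith
  have hfst : ∀ g : C(X, ℝ), ∫ p, g p.1 * Real.exp (F p) ∂μ.prod ν = ∫ x, g x ∂μ := by
    intro g
    refine integral_mul_exp_eq_of_forall_le _ hF (by fun_prop) fun t => ?_
    have h1 := hglobal (l, a + t • g, b)
    have h4 : ∀ p, F p + t * g p.1 = logKernel H l p + (a p.1 + t * g p.1) + b p.2 := fun p => by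
      simp only [F]; ring
    simp only [J, dualObjective, ContinuousMap.add_apply, ContinuousMap.smul_apply,
      smul_eq_mul] at h1
    rw [integral_add (a.continuous.integrable_of_compactSpace _)
      (Continuous.integrable_of_compactSpace (by fun_prop) _), integral_const_mul] at h1
    simp only [h4]
    simp only [F]
    linarith
  have hsnd : ∀ g : C(Y, ℝ), ∫ p, g p.2 * Real.exp (F p) ∂μ.prod ν = ∫ y, g y ∂ν := by
    intro g
    refine integral_mul_exp_eq_of_forall_le _ hF (by fun_prop) fun t => ?_
    have h1 := hglobal (l, a, b + t • g)
    have h4 : ∀ p, F p + t * g p.2 = logKernel H l p + a p.1 + (b p.2 + t * g p.2) := fun p => by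
      simp only [F]; ring
    simp only [J, dualObjective, ContinuousMap.add_apply, ContinuousMap.smul_apply,
      smul_eq_mul] at h1
    rw [integral_add (b.continuous.integrable_of_compactSpace _)
      (Continuous.integrable_of_compactSpace (by fun_prop) _), integral_const_mul] at h1
    simp only [h4]
    simp only [F]
    linarith
  refine ⟨l, a, b, ?_, ?_, ?_⟩
  · have hm := continuous_integral_snd ν hF.rexp
    have := eq_one_of_forall_integral_mul μ hm fun g => by
      rw [← hfst g, integral_prod _ (Continuous.integrable_of_compactSpace (by fun_prop) _)]
      simp only [integral_const_mul]
    simpa only [F, logKernel_apply] using this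
  · have hm := continuous_integral_fst μ hF.rexp
    have := eq_one_of_forall_integral_mul ν hm fun g => by
      rw [← hsnd g, integral_prod_symm _ (Continuous.integrable_of_compactSpace (by fun_prop) _)]
      simp only [integral_const_mul]
    simpa only [F, logKernel_apply] using this
  · simpa only [F, logKernel_apply] using hmoment

end DualProblem

section UnitSquare

open unitInterval

instance isOpenPosMeasure_volume_unitInterval : (volume : Measure I).IsOpenPosMeasure where
  open_pos U hU hne := by
    obtain ⟨V, hV, rfl⟩ := isOpen_induced_iff.1 hU
    obtain ⟨x, hx⟩ := hne
    have hcl : (x : ℝ) ∈ closure (Ioo (0 : ℝ) 1) := by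
      rw [closure_Ioo zero_ne_one]
      exact x.2
    have hpos : 0 < volume (V ∩ Ioo (0 : ℝ) 1) :=
      (hV.inter isOpen_Ioo).measure_pos _ (mem_closure_iff.1 hcl V hV hx)
    rw [unitInterval.volume_apply]
    refine (hpos.trans_le (measure_mono ?_)).ne'
    rintro y ⟨hyV, hy⟩
    exact ⟨⟨y, Ioo_subset_Icc_self hy⟩, hyV, rfl⟩

theorem setIntegral_unitSquare (f : ℝ × ℝ → ℝ) :
    ∫ p in unitSquare, f p = ∫ p : I × I, f (p.1, p.2) ∂(volume.prod volume) := by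
  have hmp := unitInterval.measurePreserving_coe.prod unitInterval.measurePreserving_coe
  rw [Measure.prod_restrict] at hmp
  exact (hmp.integral_comp (unitInterval.measurableEmbedding_coe.prodMap
    unitInterval.measurableEmbedding_coe) f).symm

theorem intervalIntegral_eq_integral_unitInterval (f : ℝ → ℝ) :
    ∫ t in (0 : ℝ)..1, f t = ∫ t : I, f t := by
  rw [intervalIntegral.integral_of_le zero_le_one, ← integral_Icc_eq_integral_Ioc]
  exact (integral_subtype measurableSet_Icc f).symm

/-- The restriction to `[0,1]²` of a function that is continuous there, as a continuous map. -/
def restrictUnitSquare (f : ℝ → ℝ → ℝ)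
    (hf : ContinuousOn (fun p : ℝ × ℝ => f p.1 p.2) unitSquare) : C(I × I, ℝ) :=
  ⟨fun p => f p.1 p.2, hf.comp_continuous (f := fun p : I × I => ((p.1 : ℝ), (p.2 : ℝ)))
    (by fun_prop) fun p => ⟨p.1.2, p.2.2⟩⟩

end UnitSquare

/-- **Existence of the minimum information copula with prescribed moments.** If
`h₁, …, h_k` are continuous linearly independent functions on `[0,1]²` and the target moment
vector `α` lies in the interior of the set of moment vectors attainable by copula densities,
then there are parameters `λ₁, …, λ_k` and continuous strictly positive reweighting functions
`d₁, d₂` such that `c* (u,v) = d₁ u * d₂ v * exp (∑ i, λ i * h i u v)` is a copula density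
whose moments `∫∫ hᵢ c*` are exactly the `αᵢ`. -/
theorem minimum_information_copula_exists (k : ℕ) (h : Fin k → ℝ → ℝ → ℝ)
    (hcont : ∀ i, ContinuousOn (fun p : ℝ × ℝ => h i p.1 p.2) unitSquare)
    (hli : LinearIndependent ℝ
      (fun i : Fin k => fun p : (Set.Icc (0:ℝ) 1) × (Set.Icc (0:ℝ) 1) =>
        h i p.1 p.2))
    (α : Fin k → ℝ)
    (hα : α ∈ interior {β : Fin k → ℝ | ∃ c : ℝ → ℝ → ℝ, IsCopulaDensity c ∧
      ∀ i, β i = ∫ p in unitSquare, h i p.1 p.2 * c p.1 p.2}) :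
    ∃ lam : Fin k → ℝ, ∃ d1 d2 : ℝ → ℝ,
      ContinuousOn d1 (Set.Icc (0:ℝ) 1) ∧ ContinuousOn d2 (Set.Icc (0:ℝ) 1) ∧
      (∀ u ∈ Set.Icc (0:ℝ) 1, 0 < d1 u) ∧ (∀ v ∈ Set.Icc (0:ℝ) 1, 0 < d2 v) ∧
      IsCopulaDensity (fun u v => d1 u * d2 v * Real.exp (∑ i, lam i * h i u v)) ∧
      ∀ i, (∫ p in unitSquare,
          h i p.1 p.2 * (d1 p.1 * d2 p.2 * Real.exp (∑ j, lam j * h j p.1 p.2)))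
        = α i := by
  let H : Fin k → C(unitInterval × unitInterval, ℝ) := fun i => restrictUnitSquare (h i) (hcont i)
  have hα' : α ∈ interior {β : Fin k → ℝ | ∃ c : C(unitInterval × unitInterval, ℝ),
      (∀ p, 0 ≤ c p) ∧ (∀ x, ∫ y, c (x, y) = 1) ∧ (∀ y, ∫ x, c (x, y) = 1) ∧
      ∀ i, β i = ∫ p, H i p * c p ∂(volume.prod volume)} := by
    refine interior_mono ?_ hα
    rintro β ⟨c, ⟨hc, hc0, hc1, hc2⟩, hβ⟩
    refine ⟨restrictUnitSquare c hc, fun p => hc0 _ p.1.2 _ p.2.2, fun x => ?_, fun y => ?_,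
      fun i => ?_⟩
    · rw [← hc1 x x.2, intervalIntegral_eq_integral_unitInterval]
      rfl
    · rw [← hc2 y y.2, intervalIntegral_eq_integral_unitInterval]
      rfl
    · rw [hβ i, setIntegral_unitSquare]
      rfl
  obtain ⟨l, a, b, h1, h2, h3⟩ := exists_minimum_information_density volume volume H α hα'
  let d1 : ℝ → ℝ := fun u => Real.exp (IccExtend zero_le_one a u)
  let d2 : ℝ → ℝ := fun v => Real.exp (IccExtend zero_le_one b v)
  have hd1 : Continuous d1 := a.continuous.Icc_extend'.rexp
  have hd2 : Continuous d2 := b.continuous.Icc_extend'.rexp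
  have hval : ∀ x y : unitInterval, d1 x * d2 y * Real.exp (∑ i, l i * h i x y) =
      Real.exp (∑ i, l i * H i (x, y) + a x + b y) := by
    intro x y
    simp only [d1, d2, IccExtend_val, Real.exp_add]
    exact mul_comm _ _ |>.trans (mul_assoc _ _ _).symm
  refine ⟨l, d1, d2, hd1.continuousOn, hd2.continuousOn, fun _ _ => Real.exp_pos _,
    fun _ _ => Real.exp_pos _, ⟨?_, fun u _ v _ => by positivity, fun u hu => ?_, fun v hv => ?_⟩,
    fun i => ?_⟩
  · fun_prop
  · rw [intervalIntegral_eq_integral_unitInterval, ← h1 ⟨u, hu⟩]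
    exact integral_congr_ae (.of_forall fun y => hval ⟨u, hu⟩ y)
  · rw [intervalIntegral_eq_integral_unitInterval, ← h2 ⟨v, hv⟩]
    exact integral_congr_ae (.of_forall fun x => hval x ⟨v, hv⟩)
  · rw [setIntegral_unitSquare, ← h3 i]
    exact integral_congr_ae (.of_forall fun p => congrArg (h i p.1 p.2 * ·) (hval p.1 p.2))
end
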